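/- arXiv:2109.10332 — 2 statements merged into one kernel-verified Lean document; each statement's English description precedes it below -/
import Mathlib

section
/- Let R be a commutative ring of positive Krull dimension. Then there exists a morphism from the affine line A^1_R to the projective line P^1 over the integers that cannot be extended to a morphism from P^1_R to P^1. -/
open AlgebraicGeometry CategoryTheory HomogeneousLocalization

attribute [local instance] MvPolynomial.gradedAlgebra

/-- The projective line over a commutative ring `R`, as `Proj R[X₀, X₁]`. -/
noncomputable def ProjLine (R : Type) [CommRing R] : Scheme :=
  Proj (MvPolynomial.homogeneousSubmodule (Fin 2) R)

/-- The affine line over `R`, realized as the standard affine chart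
`Spec ((R[X₀, X₁])_{X₁})₀` of the projective line over `R`. -/
noncomputable def AffLine (R : Type) [CommRing R] : Scheme :=
  Spec (.of (Away (MvPolynomial.homogeneousSubmodule (Fin 2) R) (MvPolynomial.X 1)))

lemma X1_mem_deg_one (R : Type) [CommRing R] :
    MvPolynomial.X 1 ∈ MvPolynomial.homogeneousSubmodule (Fin 2) R 1 :=
  (MvPolynomial.mem_homogeneousSubmodule _ _).mpr (MvPolynomial.isHomogeneous_X _ _)

/-- The standard open immersion `𝔸¹_R ⟶ ℙ¹_R`. -/
noncomputable def affToProjLine (R : Type) [CommRing R] : AffLine R ⟶ ProjLine R :=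
  Proj.awayι (MvPolynomial.homogeneousSubmodule (Fin 2) R) (MvPolynomial.X 1)
    (X1_mem_deg_one R) one_pos

section Helpers

open MvPolynomial

local notation "Gr" R:max => MvPolynomial.homogeneousSubmodule (Fin 2) R

lemma Xi_mem (R : Type) [CommRing R] (i : Fin 2) :
    (X i : MvPolynomial (Fin 2) R) ∈ (Gr R) 1 :=
  (MvPolynomial.mem_homogeneousSubmodule _ _).mpr (MvPolynomial.isHomogeneous_X _ _)

/-- evaluation of degree zero fractions. -/
noncomputable def evAway {R S : Type} [CommRing R] [CommRing S]
    (θ : MvPolynomial (Fin 2) R →+* S) (f : MvPolynomial (Fin 2) R) (h : IsUnit (θ f)) :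
    Away (Gr R) f →+* S :=
  (Localization.awayLift θ f h).comp (algebraMap (Away (Gr R) f) (Localization.Away f))

lemma evAway_mk {R S : Type} [CommRing R] [CommRing S]
    (θ : MvPolynomial (Fin 2) R →+* S) (f : MvPolynomial (Fin 2) R) (h : IsUnit (θ f))
    {d : ℕ} (hf : f ∈ (Gr R) d) (n : ℕ) (x : MvPolynomial (Fin 2) R) (hx : x ∈ (Gr R) (n • d)) :
    evAway θ f h (Away.mk (Gr R) hf n x hx) * θ f ^ n = θ x := by
  obtain ⟨v, hv⟩ := h.exists_right_inv
  rw [evAway, RingHom.comp_apply, HomogeneousLocalization.algebraMap_apply, Away.val_mk,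
    Localization.awayLift_mk (hv := hv), mul_assoc, ← mul_pow, mul_comm v, hv, one_pow, mul_one]

lemma evAway_comp {R S : Type} [CommRing R] [CommRing S]
    (θ : MvPolynomial (Fin 2) R →+* S) (f g x : MvPolynomial (Fin 2) R) (h : IsUnit (θ f))
    (h' : IsUnit (θ x)) {d e : ℕ} (hf : f ∈ (Gr R) d) (hg : g ∈ (Gr R) e) (hx : x = f * g) :
    (evAway θ x h').comp (awayMap (Gr R) hg hx) = evAway θ f h := by
  ext z
  obtain ⟨n, a, ha, rfl⟩ := Away.mk_surjective (Gr R) hf z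
  rw [RingHom.comp_apply, awayMap_mk]
  apply (h'.pow n).mul_left_injective
  dsimp only
  rw [evAway_mk, hx, map_mul, map_mul, mul_pow, ← mul_assoc, evAway_mk, map_pow]

lemma evAway_postcomp {R S T : Type} [CommRing R] [CommRing S] [CommRing T]
    (θ : MvPolynomial (Fin 2) R →+* S) (k : S →+* T) (f : MvPolynomial (Fin 2) R)
    (h : IsUnit (θ f)) (h' : IsUnit (k.comp θ f)) :
    k.comp (evAway θ f h) = evAway (k.comp θ) f h' := by
  have key : k.comp (Localization.awayLift θ f h) = Localization.awayLift (k.comp θ) f h' := by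
    apply IsLocalization.ringHom_ext (Submonoid.powers f)
    ext <;> simp [Localization.awayLift]
  rw [evAway, evAway, ← key, RingHom.comp_assoc]

lemma ev_glue {R S : Type} [CommRing R] [CommRing S]
    (θ : MvPolynomial (Fin 2) R →+* S) (h0 : IsUnit (θ (X 0))) (h1 : IsUnit (θ (X 1))) :
    Spec.map (CommRingCat.ofHom (evAway θ (X 0) h0)) ≫
      Proj.awayι (Gr R) (X 0) (Xi_mem R 0) one_pos =
    Spec.map (CommRingCat.ofHom (evAway θ (X 1) h1)) ≫
      Proj.awayι (Gr R) (X 1) (Xi_mem R 1) one_pos := by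
  have h' : IsUnit (θ (X 0 * X 1)) := by rw [map_mul]; exact h0.mul h1
  rw [← evAway_comp θ (X 0) (X 1) (X 0 * X 1) h0 h' (Xi_mem R 0) (Xi_mem R 1) rfl,
    ← evAway_comp θ (X 1) (X 0) (X 0 * X 1) h1 h' (Xi_mem R 1) (Xi_mem R 0) (mul_comm _ _),
    CommRingCat.ofHom_comp, CommRingCat.ofHom_comp, Spec.map_comp, Spec.map_comp,
    Category.assoc, Category.assoc, Proj.SpecMap_awayMap_awayι, Proj.SpecMap_awayMap_awayι]

/-- the coordinate `X j / X i`. -/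
noncomputable def coord (R : Type) [CommRing R] (i j : Fin 2) :
    Away (Gr R) (X i : MvPolynomial (Fin 2) R) :=
  Away.mk (Gr R) (Xi_mem R i) 1 (X j) (by simpa using Xi_mem R j)

lemma evAway_coord {R S : Type} [CommRing R] [CommRing S]
    (θ : MvPolynomial (Fin 2) R →+* S) (i j : Fin 2) (h : IsUnit (θ (X i))) :
    evAway θ (X i) h (coord R i j) * θ (X i) = θ (X j) := by
  have := evAway_mk θ (X i) h (Xi_mem R i) 1 (X j) (by simpa using Xi_mem R j)
  rw [pow_one] at this
  exact this

lemma coord_mul {R S : Type} [CommRing R] [CommRing S]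
    (α : Away (Gr R) (X 1 : MvPolynomial (Fin 2) R) →+* S)
    (β : Away (Gr R) (X 0 : MvPolynomial (Fin 2) R) →+* S)
    (h : Spec.map (CommRingCat.ofHom β) ≫ Proj.awayι (Gr R) (X 0) (Xi_mem R 0) one_pos =
      Spec.map (CommRingCat.ofHom α) ≫ Proj.awayι (Gr R) (X 1) (Xi_mem R 1) one_pos) :
    α (coord R 1 0) * β (coord R 0 1) = 1 := by
  let e := Proj.pullbackAwayιIso (Gr R) (Xi_mem R 0) one_pos (Xi_mem R 1) one_pos rfl
  let m := Limits.pullback.lift _ _ h ≫ e.hom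
  obtain ⟨φ, hφ⟩ := Spec.map_surjective m
  have hb : CommRingCat.ofHom β = CommRingCat.ofHom (awayMap (Gr R) (Xi_mem R 1) rfl) ≫ φ := by
    apply Spec.map_injective
    rw [Spec.map_comp, hφ, Category.assoc, Proj.pullbackAwayιIso_hom_SpecMap_awayMap_left,
      Limits.pullback.lift_fst]
  have ha : CommRingCat.ofHom α =
      CommRingCat.ofHom (awayMap (Gr R) (Xi_mem R 0) (mul_comm _ _)) ≫ φ := by
    apply Spec.map_injective
    rw [Spec.map_comp, hφ, Category.assoc, Proj.pullbackAwayιIso_hom_SpecMap_awayMap_right,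
      Limits.pullback.lift_snd]
  have hb' : β (coord R 0 1) = φ.hom (awayMap (Gr R) (Xi_mem R 1) rfl (coord R 0 1)) :=
    congrArg (fun m => m.hom (coord R 0 1)) hb
  have ha' : α (coord R 1 0) =
      φ.hom (awayMap (Gr R) (Xi_mem R 0) (mul_comm _ _) (coord R 1 0)) :=
    congrArg (fun m => m.hom (coord R 1 0)) ha
  rw [ha', hb', ← map_mul, ← map_one φ.hom]
  congr 1
  ext
  rw [coord, coord, awayMap_mk, awayMap_mk]
  simp only [val_mul, val_one, Away.val_mk, Localization.mk_mul]
  rw [← Localization.mk_one, Localization.mk_eq_mk_iff, Localization.r_iff_exists]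
  use 1
  simp only [OneMemClass.coe_one, one_mul, Submonoid.coe_mul, mul_one]
  ring

lemma cover_top (R : Type) [CommRing R] :
    ⨆ i : Fin 2, Proj.basicOpen (Gr R) (X i) = ⊤ := by
  apply Proj.iSup_basicOpen_eq_top'
  · exact fun i => ⟨1, Xi_mem R i⟩
  · rw [eq_top_iff]
    intro p _
    induction p using MvPolynomial.induction_on with
    | C r =>
      exact Subalgebra.algebraMap_mem _
        (⟨C r, (mem_homogeneousSubmodule _ _).mpr (isHomogeneous_C _ _)⟩ : (Gr R) 0)
    | add p q hp hq => exact add_mem (hp trivial) (hq trivial)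
    | mul_X p i hp => exact mul_mem (hp trivial) (Algebra.subset_adjoin ⟨i, rfl⟩)

lemma local_factor {R A : Type} [CommRing R] [CommRing A] [IsLocalRing A]
    (k : Spec (.of A) ⟶ Proj (Gr R)) :
    ∃ (i : Fin 2) (φ : Away (Gr R) (X i : MvPolynomial (Fin 2) R) →+* A),
      k = Spec.map (CommRingCat.ofHom φ) ≫
        Proj.awayι (Gr R) (X i) (Xi_mem R i) one_pos := by
  have hx : k (IsLocalRing.closedPoint A) ∈ ⨆ i : Fin 2, Proj.basicOpen (Gr R) (X i) := by
    rw [cover_top]; trivial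
  obtain ⟨i, hi⟩ := TopologicalSpace.Opens.mem_iSup.mp hx
  have hU : k ⁻¹ᵁ (Proj.basicOpen (Gr R) (X i)) = ⊤ :=
    IsLocalRing.closed_point_mem_iff.mp hi
  have hr : Set.range k ⊆ Set.range (Proj.awayι (Gr R) (X i) (Xi_mem R i) one_pos) := by
    rintro _ ⟨y, rfl⟩
    change k y ∈ (Proj.awayι (Gr R) (X i) (Xi_mem R i) one_pos).opensRange
    rw [Proj.opensRange_awayι]
    change y ∈ k ⁻¹ᵁ (Proj.basicOpen (Gr R) (X i))
    rw [hU]; trivial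
  obtain ⟨φ, hφ⟩ := Spec.map_surjective (IsOpenImmersion.lift _ k hr)
  refine ⟨i, φ.hom, ?_⟩
  rw [CommRingCat.ofHom_hom, hφ, IsOpenImmersion.lift_fac]

lemma exists_local (R : Type) [CommRing R] (h : 0 < ringKrullDim R) :
    ∃ (L : Type) (_ : CommRing L) (_ : IsDomain L) (_ : IsLocalRing L) (ρ : R →+* L) (a : R),
      ρ a ≠ 0 ∧ ¬ IsUnit (ρ a) := by
  obtain ⟨p, q, hpq⟩ := Order.krullDim_pos_iff.mp h
  obtain ⟨a, haq, hap⟩ := SetLike.exists_of_lt (show p.asIdeal < q.asIdeal from hpq)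
  let Rq := Localization.AtPrime q.asIdeal
  have hd : Disjoint (q.asIdeal.primeCompl : Set R) (p.asIdeal : Set R) := by
    rw [Set.disjoint_left]
    intro x hx hx'
    exact hx (hpq.le hx')
  let P : Ideal Rq := p.asIdeal.map (algebraMap R Rq)
  have hP : P.IsPrime := IsLocalization.isPrime_of_isPrime_disjoint _ _ _ p.2 hd
  have hloc : IsLocalRing (Rq ⧸ P) :=
    IsLocalRing.of_surjective' (Ideal.Quotient.mk P) Ideal.Quotient.mk_surjective
  refine ⟨Rq ⧸ P, inferInstance, inferInstance, hloc,
    (Ideal.Quotient.mk P).comp (algebraMap R Rq), a, ?_, ?_⟩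
  · rw [RingHom.comp_apply, Ne, Ideal.Quotient.eq_zero_iff_mem]
    intro ha
    apply hap
    rw [← IsLocalization.under_map_of_isPrime_disjoint q.asIdeal.primeCompl Rq p.2 hd]
    exact ha
  · rw [RingHom.comp_apply]
    have : IsLocalHom (Ideal.Quotient.mk P) :=
      IsLocalHom.of_surjective _ Ideal.Quotient.mk_surjective
    intro hu
    have := isUnit_of_map_unit _ _ hu
    exact (IsLocalization.AtPrime.isUnit_to_map_iff Rq q.asIdeal a).mp this haq

end Helpers

/-- Let `R` be a commutative ring of positive Krull dimension. Then there is a morphism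
`𝔸¹_R ⟶ ℙ¹_ℤ` that cannot be extended, along the standard open immersion
`𝔸¹_R ⟶ ℙ¹_R`, to a morphism `ℙ¹_R ⟶ ℙ¹_ℤ`. -/
theorem stmt_0 (R : Type) [CommRing R] (h : 0 < ringKrullDim R) :
    ∃ f : AffLine R ⟶ ProjLine ℤ,
      ¬ ∃ g : ProjLine R ⟶ ProjLine ℤ, affToProjLine R ≫ g = f := by
  obtain ⟨L, _, _, _, ρ, a, ha0, hau⟩ := exists_local R h
  let A := PowerSeries L
  obtain ⟨K, _, ι, hι⟩ : ∃ (K : Type) (_ : Field K) (ι : A →+* K), Function.Injective ι :=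
    ⟨FractionRing A, inferInstance, algebraMap A _, IsFractionRing.injective A _⟩
  let s : A := PowerSeries.X
  have hs : ι s ≠ 0 := by
    rw [Ne, map_eq_zero_iff _ hι]; exact PowerSeries.X_ne_zero
  -- the map `f`
  let B := Away (MvPolynomial.homogeneousSubmodule (Fin 2) R) (MvPolynomial.X 1)
  let a' : B := fromZeroRingHom (MvPolynomial.homogeneousSubmodule (Fin 2) R) _
    ⟨MvPolynomial.C a, (MvPolynomial.mem_homogeneousSubmodule _ _).mpr
      (MvPolynomial.isHomogeneous_C _ _)⟩
  let θ : MvPolynomial (Fin 2) ℤ →+* B :=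
    MvPolynomial.eval₂Hom (Int.castRingHom B) ![a' * coord R 1 0, 1]
  have hθ : IsUnit (θ (MvPolynomial.X 1)) := by simp [θ]
  let F : Away (MvPolynomial.homogeneousSubmodule (Fin 2) ℤ) (MvPolynomial.X 1) →+* B :=
    evAway θ (MvPolynomial.X 1) hθ
  have hF : F (coord ℤ 1 0) = a' * coord R 1 0 := by
    have := evAway_coord θ 1 0 hθ
    simpa [θ] using this
  refine ⟨Spec.map (CommRingCat.ofHom F) ≫
    Proj.awayι (MvPolynomial.homogeneousSubmodule (Fin 2) ℤ) (MvPolynomial.X 1)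
      (Xi_mem ℤ 1) one_pos, ?_⟩
  rintro ⟨g, hg⟩
  -- the test point
  let τ : MvPolynomial (Fin 2) R →+* A :=
    MvPolynomial.eval₂Hom ((PowerSeries.C (R := L)).comp ρ) ![1, s]
  have hτ0 : IsUnit (τ (MvPolynomial.X 0)) := by simp [τ]
  have hκ0 : IsUnit (ι.comp τ (MvPolynomial.X 0)) := hτ0.map ι
  have hκ1 : IsUnit (ι.comp τ (MvPolynomial.X 1)) := by
    have : ι.comp τ (MvPolynomial.X 1) = ι s := by simp [τ]
    rw [this]
    exact hs.isUnit
  let k : Spec (.of A) ⟶ ProjLine R :=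
    Spec.map (CommRingCat.ofHom (evAway τ (MvPolynomial.X 0) hτ0)) ≫
      Proj.awayι (MvPolynomial.homogeneousSubmodule (Fin 2) R) (MvPolynomial.X 0)
        (Xi_mem R 0) one_pos
  let G := evAway (ι.comp τ) (MvPolynomial.X 1) hκ1
  have hG : G (coord R 1 0) * ι s = 1 := by
    have := evAway_coord (ι.comp τ) 1 0 hκ1
    have e0 : ι.comp τ (MvPolynomial.X 0) = 1 := by simp [τ]
    have e1 : ι.comp τ (MvPolynomial.X 1) = ι s := by simp [τ]
    rw [e0] at this
    exact (congrArg _ e1.symm).trans this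
  have hGa : G a' = ι (PowerSeries.C (ρ a)) := by
    have : a' = Away.mk _ (Xi_mem R 1) 0 (MvPolynomial.C a)
      ((MvPolynomial.mem_homogeneousSubmodule _ _).mpr (by
        simpa using MvPolynomial.isHomogeneous_C _ _)) := by
      ext
      rw [Away.val_mk]
      simp only [pow_zero]
      rfl
    rw [this]
    have := evAway_mk (ι.comp τ) _ hκ1 (Xi_mem R 1) 0 (MvPolynomial.C a)
      ((MvPolynomial.mem_homogeneousSubmodule _ _).mpr (by
        simpa using MvPolynomial.isHomogeneous_C _ _))
    rw [pow_zero, mul_one] at this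
    exact this.trans (by simp [τ])
  have hk : Spec.map (CommRingCat.ofHom ι) ≫ k =
      Spec.map (CommRingCat.ofHom G) ≫ affToProjLine R := by
    have := ev_glue (ι.comp τ) hκ0 hκ1
    rw [← evAway_postcomp τ ι _ hτ0 hκ0, CommRingCat.ofHom_comp, Spec.map_comp,
      Category.assoc] at this
    exact this
  have hα : (G.comp F) (coord ℤ 1 0) * ι s = ι (PowerSeries.C (ρ a)) := by
    rw [RingHom.comp_apply, hF, map_mul, mul_assoc, hG, hGa, mul_one]
  obtain ⟨i, φ, hφ⟩ := local_factor (R := ℤ) (A := A) (k ≫ g)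
  have main : Spec.map (CommRingCat.ofHom (ι.comp φ)) ≫
        Proj.awayι (MvPolynomial.homogeneousSubmodule (Fin 2) ℤ) (MvPolynomial.X i)
          (Xi_mem ℤ i) one_pos =
      Spec.map (CommRingCat.ofHom (G.comp F)) ≫
        Proj.awayι (MvPolynomial.homogeneousSubmodule (Fin 2) ℤ) (MvPolynomial.X 1)
          (Xi_mem ℤ 1) one_pos := by
    rw [CommRingCat.ofHom_comp, CommRingCat.ofHom_comp, Spec.map_comp, Spec.map_comp,
      Category.assoc, Category.assoc]
    refine (congrArg (Spec.map (CommRingCat.ofHom ι) ≫ ·) hφ).symm.trans ?_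
    refine Eq.trans ?_ (congrArg (Spec.map (CommRingCat.ofHom G) ≫ ·) hg)
    exact (Category.assoc _ _ _).symm.trans ((congrArg (· ≫ g) hk).trans (Category.assoc _ _ _))
  fin_cases i
  · have h1 := coord_mul (G.comp F) (ι.comp φ) main
    have h2 : PowerSeries.C (ρ a) * φ (coord ℤ 0 1) = s := by
      apply hι
      rw [map_mul, ← hα, mul_right_comm]
      erw [h1]
      rw [one_mul]
    have h3 := congrArg (PowerSeries.coeff 1) h2
    rw [PowerSeries.coeff_C_mul] at h3
    apply hau
    exact IsUnit.of_mul_eq_one _ (h3.trans (by simp [s]))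
  · have h1 : CommRingCat.ofHom (ι.comp φ) = CommRingCat.ofHom (G.comp F) :=
      Spec.map_injective ((cancel_mono _).mp main)
    have h2 : φ (coord ℤ 1 0) * s = PowerSeries.C (ρ a) := by
      apply hι
      rw [← hα, map_mul]
      congr 1
      exact congrArg (fun m => m.hom (coord ℤ 1 0)) h1
    have h3 := congrArg (PowerSeries.constantCoeff) h2
    apply ha0
    simpa [s] using h3.symm
end

section
/- Let R be a Noetherian local integral domain which is integrally closed (normal). Then the Picard group of the polynomial ring R[s] is trivial: every invertible R[s]-module is free of rank one. -/
universe u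

open Polynomial CommRing in
theorem aux_integral {R K : Type*} [CommRing R] [Field K] [Algebra R K]
    [FaithfulSMul R K] (a b : K[X]) (p : R[X]) (ha : a.coeff 0 = 1) (hb : b.coeff 0 = 1)
    (h : a * b = p.map (algebraMap R K)) (i : ℕ) : IsIntegral R (a.coeff i) := by
  have inj := FaithfulSMul.algebraMap_injective R K
  have hp : p.coeff 0 = 1 := by
    apply inj
    rw [← coeff_map, ← h, mul_coeff_zero, ha, hb]; simp
  have mon : ∀ {S : Type _} [CommRing S] [Nontrivial S] (q : S[X]), q.coeff 0 = 1 → q.reverse.Monic := by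
    intro S _ _ q hq
    rw [Monic, reverse_leadingCoeff, trailingCoeff,
      natTrailingDegree_eq_zero.mpr (Or.inr (by simp [hq])), hq]
  have mon' : p.reverse.Monic := by
    have : Nontrivial R := (algebraMap R K).domain_nontrivial
    rw [Monic, reverse_leadingCoeff, trailingCoeff,
      natTrailingDegree_eq_zero.mpr (Or.inr (by simp [hp])), hp]
  have hr : p.reverse.map (algebraMap R K) = a.reverse * b.reverse := by
    rw [← reverse_mul_of_domain, h]
    simp only [reverse]
    rw [reflect_map, natDegree_map_eq_of_injective inj]
  have := isIntegral_coeff_of_dvd p.reverse a.reverse mon' (mon a ha) ⟨_, hr⟩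
    (revAt a.natDegree i)
  rwa [coeff_reverse, revAt_invol] at this

open Polynomial in
theorem aux_div {R K : Type*} [CommRing R] [Field K] [Algebra R K]
    (a h : K[X]) (ha : a.coeff 0 = 1) (hai : ∀ i, IsIntegral R (a.coeff i))
    (hh : ∀ i, IsIntegral R ((a * h).coeff i)) (n : ℕ) : IsIntegral R (h.coeff n) := by
  induction n using Nat.strong_induction_on with
  | _ n ih =>
    have := hh n
    rw [coeff_mul, Finset.Nat.sum_antidiagonal_eq_sum_range_succ_mk,
      Finset.sum_range_succ'] at this
    simp only [ha, one_mul, Nat.sub_zero] at this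
    have h2 : IsIntegral R (∑ k ∈ Finset.range n, a.coeff (k + 1) * h.coeff (n - (k + 1))) := by
      refine IsIntegral.sum _ fun k hk => (hai _).mul (ih _ ?_)
      have := Finset.mem_range.mp hk
      omega
    simpa using this.sub h2

open Polynomial in
theorem aux_range {R K : Type*} [CommRing R] [Field K] [Algebra R K] [IsDomain R]
    [IsFractionRing R K] [IsIntegrallyClosed R]
    (h : K[X]) (hh : ∀ i, IsIntegral R (h.coeff i)) : ∃ q : R[X], q.map (algebraMap R K) = h := by
  have : h ∈ Polynomial.lifts (algebraMap R K) := by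
    rw [Polynomial.lifts_iff_coeff_lifts]
    intro n
    exact IsIntegrallyClosed.isIntegral_iff.mp (hh n)
  exact (Polynomial.mem_lifts _).mp this

open Polynomial in
/-- the key divisibility fact -/
theorem aux_key {R K : Type*} [CommRing R] [Field K] [Algebra R K] [IsDomain R]
    [IsFractionRing R K] [IsIntegrallyClosed R]
    (f g h : K[X]) (p r : R[X]) (h0 : f.coeff 0 * g.coeff 0 = 1)
    (hp : f * g = p.map (algebraMap R K)) (hr : f * h = r.map (algebraMap R K)) :
    ∃ q : R[X], q.map (algebraMap R K) = C (f.coeff 0) * h := by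
  have hc : f.coeff 0 ≠ 0 := left_ne_zero_of_mul_eq_one h0
  set c := f.coeff 0 with hcdef
  have e : C c⁻¹ * C c = (1 : K[X]) := by rw [← C_mul, inv_mul_cancel₀ hc, C_1]
  have ha : (C c⁻¹ * f).coeff 0 = 1 := by
    rw [coeff_C_mul, ← hcdef, inv_mul_cancel₀ hc]
  have hb : (C c * g).coeff 0 = 1 := by rw [coeff_C_mul, h0]
  apply aux_range
  apply aux_div (C c⁻¹ * f) _ ha
  · apply aux_integral _ (C c * g) p ha hb
    rw [← hp]
    linear_combination (f * g) * e
  · intro i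
    have : C c⁻¹ * f * (C c * h) = r.map (algebraMap R K) := by
      rw [← hr]
      linear_combination (f * h) * e
    rw [this, coeff_map]
    exact isIntegral_algebraMap

open Polynomial CommRing in
theorem aux_main (R : Type u) [CommRing R] [IsDomain R]
    [IsLocalRing R] [IsIntegrallyClosed R] : Subsingleton (Pic R[X]) := by
  let K := FractionRing R
  let : Algebra R[X] K[X] := (mapRingHom (algebraMap R K)).toAlgebra
  have hmap : ∀ q : R[X], algebraMap R[X] K[X] q = q.map (algebraMap R K) := fun q => rfl
  have inj : Function.Injective (algebraMap R K) := FaithfulSMul.algebraMap_injective R K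
  have : FaithfulSMul R[X] K[X] := by
    rw [faithfulSMul_iff_algebraMap_injective]
    exact map_injective _ inj
  have key : ∀ M : Pic R[X], M = 1 := by
    intro M
    have hM : M ∈ (Submodule.unitsToPic R[X] K[X]).range := by
      rw [Submodule.range_unitsToPic, relPic_eq_top]; trivial
    obtain ⟨I, rfl⟩ := hM
    rw [← MonoidHom.mem_ker, Submodule.ker_unitsToPic]
    have hIJ : ∀ f ∈ I.1, ∀ g ∈ I⁻¹.1, ∃ p : R[X], f * g = p.map (algebraMap R K) := by
      intro f hf g hg
      have : f * g ∈ (1 : Submodule R[X] K[X]) := by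
        rw [← I.mul_inv]; exact Submodule.mul_mem_mul hf hg
      obtain ⟨p, hp⟩ := Submodule.mem_one.mp this
      exact ⟨p, hp.symm⟩
    have h1 : (1 : K[X]) ∈ I.1 * I⁻¹.1 := by
      rw [I.mul_inv]; exact Submodule.one_le.mp le_rfl
    have hex : ∃ f ∈ I.1, ∃ g ∈ I⁻¹.1, f.coeff 0 * g.coeff 0 = 1 := by
      by_contra! hcon
      have : ∀ x ∈ I.1 * I⁻¹.1, ∃ m ∈ IsLocalRing.maximalIdeal R,
          algebraMap R K m = x.coeff 0 := by
        intro x hx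
        induction hx using Submodule.mul_induction_on' with
        | mem_mul_mem f hf g hg =>
          obtain ⟨p, hp⟩ := hIJ f hf g hg
          refine ⟨p.coeff 0, ?_, by rw [hp, coeff_map]⟩
          rw [IsLocalRing.mem_maximalIdeal, mem_nonunits_iff]
          intro hu
          obtain ⟨v, hv⟩ := hu.exists_right_inv
          refine hcon f hf ((C v : R[X]) • g) (Submodule.smul_mem _ _ hg) ?_
          rw [Algebra.smul_def, hmap, map_C, coeff_C_mul, mul_left_comm, ← mul_coeff_zero, hp,
            coeff_map, ← map_mul, mul_comm v, hv, map_one]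
        | add x _ y _ hx hy =>
          obtain ⟨a, ha, ha'⟩ := hx
          obtain ⟨b, hb, hb'⟩ := hy
          exact ⟨a + b, add_mem ha hb, by rw [map_add, ha', hb', coeff_add]⟩
      obtain ⟨m, hm, hm'⟩ := this 1 h1
      rw [coeff_one_zero, ← map_one (algebraMap R K)] at hm'
      rw [inj hm'] at hm
      exact (Ideal.ne_top_iff_one _).mp (IsLocalRing.maximalIdeal.isMaximal R).ne_top hm
    obtain ⟨f, hf, g, hg, h0⟩ := hex
    obtain ⟨p, hp⟩ := hIJ f hf g hg
    have hc : f.coeff 0 ≠ 0 := left_ne_zero_of_mul_eq_one h0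
    have hunit : IsUnit (C (f.coeff 0)) := isUnit_C.mpr hc.isUnit
    refine ⟨hunit.unit, Units.ext ?_⟩
    change Submodule.span R[X] {C (f.coeff 0)} = I.1
    apply le_antisymm
    · rw [Submodule.span_singleton_le_iff_mem]
      have : ∀ x ∈ I.1 * I⁻¹.1, C (f.coeff 0) * x ∈ I.1 := by
        intro x hx
        induction hx using Submodule.mul_induction_on' with
        | mem_mul_mem x hx y hy =>
          obtain ⟨r, hr⟩ := hIJ f hf y hy
          obtain ⟨q, hq⟩ := aux_key f g y p r h0 hp hr
          have : C (f.coeff 0) * (x * y) = q • x := by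
            rw [Algebra.smul_def, hmap, hq]; ring
          rw [this]
          exact Submodule.smul_mem _ _ hx
        | add x _ y _ hx hy => rw [mul_add]; exact add_mem hx hy
      simpa using this 1 h1
    · intro x hx
      obtain ⟨r, hr⟩ := hIJ x hx g hg
      obtain ⟨q, hq⟩ := aux_key g f x p r (by rw [mul_comm, h0]) (by rw [mul_comm, hp])
        (by rw [mul_comm, hr])
      rw [Submodule.mem_span_singleton]
      refine ⟨q, ?_⟩
      rw [Algebra.smul_def, hmap, hq, mul_right_comm, ← C_mul, mul_comm (g.coeff 0), h0, C_1,
        one_mul]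
  exact ⟨fun a b => (key a).trans (key b).symm⟩



/-- Let `R` be a Noetherian local integrally closed (normal) domain. Then every invertible
`R[s]`-module (i.e. a module `M` admitting an `N` with `M ⊗ N ≅ R[s]`) is free of rank
one: `Pic (R[s])` is trivial. -/
theorem stmt_13 (R : Type u) [CommRing R] [IsDomain R] [IsNoetherianRing R]
    [IsLocalRing R] [IsIntegrallyClosed R]
    (M N : Type u) [AddCommGroup M] [Module (Polynomial R) M]
    [AddCommGroup N] [Module (Polynomial R) N]
    (h : Nonempty (TensorProduct (Polynomial R) M N ≃ₗ[Polynomial R] Polynomial R)) :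
    Nonempty (M ≃ₗ[Polynomial R] Polynomial R) := by
  obtain ⟨e⟩ := h
  have : Module.Invertible (Polynomial R) M := .left e
  have := aux_main R
  exact (Module.Invertible.free_iff_linearEquiv).mp inferInstance
end
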